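/- For any words u, v over an alphabet and any letter a, in the shuffle algebra one has u a v = Σ_{u₁u₂ = u} (−1)^{|u₂|} u₁ ⧢ (a · (reverse(u₂) ⧢ v)), where the sum is over all factorizations of u into a prefix u₁ and suffix u₂, ⧢ denotes the shuffle product, and reverse(u₂) is the mirror image of u₂. -/

import Mathlib

/-- The multiset of shuffles of two words. -/
def shuffles {α : Type*} : List α → List α → Multiset (List α)
  | [], v => {v}
  | u, [] => {u}
  | a :: u, b :: v =>
      ((shuffles u (b :: v)).map (a :: ·)) + ((shuffles (a :: u) v).map (b :: ·))
termination_by u v => u.length + v.length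

/-- A multiset of words as an element of the free ℤ-module on words. -/
noncomputable def toFree {α : Type*} (m : Multiset (List α)) : List α →₀ ℤ :=
  (m.map (fun w => Finsupp.single w (1 : ℤ))).sum

/-- The linear map prepending the letter `c` to every word. -/
noncomputable def prepend {α : Type*} (c : α) : (List α →₀ ℤ) →+ (List α →₀ ℤ) :=
  Finsupp.mapDomain.addMonoidHom (c :: ·)

theorem toFree_add {α : Type*} (m n : Multiset (List α)) :
    toFree (m + n) = toFree m + toFree n := by
  simp [toFree]

theorem toFree_map_cons {α : Type*} (c : α) (m : Multiset (List α)) :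
    toFree (m.map (c :: ·)) = prepend c (toFree m) := by
  simp [toFree, prepend, map_multiset_sum, Finsupp.mapDomain_single]

theorem nil_shuffles {α : Type*} (v : List α) : shuffles [] v = {v} := by
  rw [shuffles]

theorem shuffles_nil {α : Type*} (u : List α) : shuffles u [] = {u} := by
  cases u <;> simp [shuffles]

theorem cons_shuffles_cons {α : Type*} (a b : α) (u v : List α) :
    shuffles (a :: u) (b :: v) =
      (shuffles u (b :: v)).map (a :: ·) + (shuffles (a :: u) v).map (b :: ·) := by
  rw [shuffles]

/-- The shuffle product `x ⧢ (y ⧢ z)` of three words. -/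
noncomputable def tripleShuffle {α : Type*} (x y z : List α) : List α →₀ ℤ :=
  toFree ((shuffles y z).bind (shuffles x))

/-- Remove the head of a word, apply `f` to the tail, and prepend the head to the result. -/
noncomputable def onTail {α : Type*} (x : List α) (f : List α → List α →₀ ℤ) : List α →₀ ℤ :=
  match x with
  | [] => 0
  | c :: x => prepend c (f x)

theorem tripleShuffle_eq_onTail {α : Type*} (x y z : List α) (h : x ≠ [] ∨ y ≠ []) :
    tripleShuffle x y z =
      onTail x (fun t => tripleShuffle t y z) + onTail y (fun t => tripleShuffle x t z) +
        onTail z (fun t => tripleShuffle x y t) := by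
  rcases x with _ | ⟨c, x⟩ <;> rcases y with _ | ⟨d, y⟩ <;> rcases z with _ | ⟨e, z⟩ <;>
    simp [tripleShuffle, onTail, nil_shuffles, shuffles_nil, cons_shuffles_cons,
      ← toFree_map_cons, toFree_add, Multiset.add_bind, Multiset.bind_add, Multiset.bind_map,
      Multiset.map_bind, Multiset.bind_singleton] at h ⊢
  all_goals abel

/-- The alternating sum of `u₁ ⧢ (reverse u₂ ⧢ v)` over all factorizations `u = u₁ u₂`. -/
noncomputable def antipodeSum {α : Type*} (u v : List α) : List α →₀ ℤ :=
  ∑ i ∈ Finset.range (u.length + 1),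
    (-1 : ℤ) ^ (u.length - i) • tripleShuffle (u.take i) (u.drop i).reverse v

theorem sum_onTail_take {α : Type*} (c : α) (u v : List α) :
    ∑ i ∈ Finset.range ((c :: u).length + 1), (-1 : ℤ) ^ ((c :: u).length - i) •
      onTail ((c :: u).take i) (fun t => tripleShuffle t ((c :: u).drop i).reverse v) =
      prepend c (antipodeSum u v) := by
  rw [Finset.sum_range_succ']
  simp [onTail, antipodeSum, map_sum, map_zsmul]

theorem sum_onTail_drop {α : Type*} (d : α) (u v : List α) :
    ∑ i ∈ Finset.range ((u ++ [d]).length + 1), (-1 : ℤ) ^ ((u ++ [d]).length - i) •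
      onTail ((u ++ [d]).drop i).reverse (fun t => tripleShuffle ((u ++ [d]).take i) t v) =
      -prepend d (antipodeSum u v) := by
  rw [Finset.sum_range_succ, antipodeSum, map_sum, ← Finset.sum_neg_distrib]
  simp only [List.drop_length, List.reverse_nil, onTail, smul_zero, add_zero]
  refine Finset.sum_congr (by simp) fun i hi => ?_
  have hi : i ≤ u.length := by simpa [Nat.lt_succ_iff] using hi
  rw [List.drop_append_of_le_length hi, List.take_append_of_le_length hi, List.length_append,
    List.length_singleton, Nat.sub_add_comm hi, pow_succ]
  simp [map_zsmul]

theorem antipodeSum_eq_zero {α : Type*} (u v : List α) (hu : u ≠ []) : antipodeSum u v = 0 := by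
  have key : antipodeSum u v =
      ∑ i ∈ Finset.range (u.length + 1), (-1 : ℤ) ^ (u.length - i) •
        onTail (u.take i) (fun t => tripleShuffle t (u.drop i).reverse v) +
      ∑ i ∈ Finset.range (u.length + 1), (-1 : ℤ) ^ (u.length - i) •
        onTail (u.drop i).reverse (fun t => tripleShuffle (u.take i) t v) +
      onTail v (fun t => antipodeSum u t) := by
    have hv : onTail v (fun t => antipodeSum u t) =
        ∑ i ∈ Finset.range (u.length + 1), (-1 : ℤ) ^ (u.length - i) •
          onTail v (fun t => tripleShuffle (u.take i) (u.drop i).reverse t) := by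
      cases v <;> simp [onTail, antipodeSum, map_sum, map_zsmul]
    rw [hv, ← Finset.sum_add_distrib, ← Finset.sum_add_distrib, antipodeSum]
    refine Finset.sum_congr rfl fun i _ => ?_
    rw [← smul_add, ← smul_add, ← tripleShuffle_eq_onTail]
    by_contra! h
    exact hu (by rw [← List.take_append_drop i u, h.1, List.reverse_eq_nil_iff.1 h.2]; rfl)
  have hv : onTail v (fun t => antipodeSum u t) = 0 := by
    rcases v with _ | ⟨e, v⟩
    · rfl
    · simp only [onTail, antipodeSum_eq_zero u v hu, map_zero]
  rw [key, hv, add_zero]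
  obtain ⟨c, s, hs⟩ := List.exists_cons_of_ne_nil hu
  obtain ⟨t, d, ht⟩ := (List.eq_nil_or_concat' u).resolve_left hu
  have h₁ := sum_onTail_take c s v
  have h₂ := sum_onTail_drop d t v
  rw [← hs] at h₁
  rw [← ht] at h₂
  rw [h₁, h₂]
  have hlen : s.length = t.length := by
    simpa [hs] using congrArg List.length ht
  by_cases hs' : s = []
  · have ht' : t = [] := by simpa [hs'] using hlen.symm
    have hcd : c = d := by simpa [hs, hs', ht'] using ht
    rw [hs', ht', hcd, add_neg_cancel]
  · have ht' : t ≠ [] := by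
      rintro rfl
      exact hs' (by simpa using hlen)
    rw [antipodeSum_eq_zero s v hs', antipodeSum_eq_zero t v ht']
    simp
termination_by u.length + v.length
decreasing_by
  · simp_all
  · simp [hs]
  · simp [ht]

theorem toFree_bind_shuffles_cons {α : Type*} (a : α) (x : List α) (m : Multiset (List α)) :
    toFree (m.bind (fun w => shuffles x (a :: w))) =
      onTail x (fun t => toFree (m.bind (fun w => shuffles t (a :: w)))) +
        prepend a (toFree (m.bind (shuffles x))) := by
  cases x <;>
    simp [onTail, nil_shuffles, cons_shuffles_cons, ← toFree_map_cons, ← toFree_add,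
      Multiset.bind_add, Multiset.map_bind, Multiset.bind_singleton]

/-- In the shuffle algebra,
`u a v = Σ_{u₁u₂=u} (−1)^{|u₂|} u₁ ⧢ (a · (reverse(u₂) ⧢ v))`. -/
theorem stmt11 {α : Type*} (u v : List α) (a : α) :
    Finsupp.single (u ++ a :: v) (1 : ℤ) =
      ∑ i ∈ Finset.range (u.length + 1),
        ((-1 : ℤ)) ^ (u.length - i) •
          toFree (((shuffles (u.drop i).reverse v)).bind
            (fun x => shuffles (u.take i) (a :: x))) := by
  induction u with
  | nil => simp [nil_shuffles, toFree]
  | cons c u ih =>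
    have hsplit : ∀ i, toFree ((shuffles ((c :: u).drop i).reverse v).bind
        (fun x => shuffles ((c :: u).take i) (a :: x))) = _ :=
      fun i => toFree_bind_shuffles_cons a ((c :: u).take i) _
    simp only [hsplit, smul_add, Finset.sum_add_distrib]
    have hzero : ∑ i ∈ Finset.range ((c :: u).length + 1), (-1 : ℤ) ^ ((c :: u).length - i) •
        prepend a (toFree ((shuffles ((c :: u).drop i).reverse v).bind
          (shuffles ((c :: u).take i)))) = 0 := by
      have h := congrArg (prepend a) (antipodeSum_eq_zero (c :: u) v (List.cons_ne_nil c u))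
      simpa only [antipodeSum, map_sum, map_zsmul, map_zero, tripleShuffle] using h
    have hcons : Finsupp.single (c :: u ++ a :: v) (1 : ℤ) =
        prepend c (Finsupp.single (u ++ a :: v) 1) := by
      simp [prepend, Finsupp.mapDomain_single]
    rw [hzero, add_zero, hcons, ih, Finset.sum_range_succ' _ (c :: u).length]
    simp [onTail, map_sum, map_zsmul]
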